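/- arXiv:2304.10052 — 3 statements merged into one kernel-verified Lean document; each statement's English description precedes it below -/
import Mathlib

section
/- Suppose Θ ⊆ ℝ^q is compact and every φ ∈ Φ is continuous on Θ. Assume (i) G_k(Θ) is distinguishable by Φ, and (ii) for every k0 ∈ {1,…,k} and every G0 ∈ E_{k0}(Θ), setting d1 = k − k0 + 1, there exist r > 0 and c > 0 such that sup_{φ∈Φ}|Gφ − Hφ| ≥ c · W_{2d1−1}(G,H)^{2d1−1} for all G ≠ H ∈ G_k(Θ) with W_1(G,G0) ≤ r and W_1(H,G0) ≤ r (the local inverse bound at G0). Then the global inverse bound holds: there exists c' > 0 such that sup_{φ∈Φ}|Gφ − Hφ| ≥ c' · W_{2k−1}(G,H)^{2k−1} for all G ≠ H ∈ G_k(Θ). -/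
open scoped BigOperators ENNReal

noncomputable section

abbrev Euc (q : ℕ) : Type := EuclideanSpace ℝ (Fin q)

def IsMixingMeasure {q : ℕ} (Θ : Set (Euc q)) (G : Euc q →₀ ℝ) : Prop :=
  (∀ x ∈ G.support, 0 < G x) ∧ (∑ x ∈ G.support, G x) = 1 ∧ ↑G.support ⊆ Θ

/-- `E_k(Θ)`: discrete probability measures on `Θ` with exactly `k` atoms. -/
def MixE {q : ℕ} (Θ : Set (Euc q)) (k : ℕ) (G : Euc q →₀ ℝ) : Prop :=
  IsMixingMeasure Θ G ∧ G.support.card = k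

/-- `G_k(Θ)`: discrete probability measures on `Θ` with at most `k` atoms. -/
def MixG {q : ℕ} (Θ : Set (Euc q)) (k : ℕ) (G : Euc q →₀ ℝ) : Prop :=
  IsMixingMeasure Θ G ∧ G.support.card ≤ k

/-- `Gφ = ∑ᵢ pᵢ φ(θᵢ)`. -/
def mixInt {q : ℕ} (G : Euc q →₀ ℝ) (φ : Euc q → ℝ) : ℝ :=
  ∑ x ∈ G.support, G x * φ x

def IsCoupling {q : ℕ} (G H : Euc q →₀ ℝ) (π : Euc q × Euc q → ℝ) : Prop :=
  (∀ p, 0 ≤ π p) ∧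
  (∀ x ∈ G.support, (∑ y ∈ H.support, π (x, y)) = G x) ∧
  (∀ y ∈ H.support, (∑ x ∈ G.support, π (x, y)) = H y)

/-- `Wpow ℓ G H = W_ℓ(G,H)^ℓ`, the minimal transport cost with cost `‖θ-θ'‖^ℓ`. -/
def Wpow {q : ℕ} (ℓ : ℝ) (G H : Euc q →₀ ℝ) : ℝ :=
  sInf { c | ∃ π : Euc q × Euc q → ℝ, IsCoupling G H π ∧
    c = ∑ p ∈ G.support ×ˢ H.support, π p * ‖p.1 - p.2‖ ^ ℓ }

/-- `sup_{φ ∈ Φ} |Gφ - Hφ|`, valued in `ℝ≥0∞`. -/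
def phiDist {q : ℕ} (Φ : Set (Euc q → ℝ)) (G H : Euc q →₀ ℝ) : ℝ≥0∞ :=
  ⨆ φ ∈ Φ, ENNReal.ofReal |mixInt G φ - mixInt H φ|

/-- Multi-indices `α ∈ ℕ^q` with `|α| ≤ n`, as a finite set. -/
def multiIdx (q n : ℕ) : Finset (Fin q → ℕ) :=
  (Fintype.piFinset fun _ : Fin q => Finset.range (n + 1)).filter fun α => (∑ j, α j) ≤ n

def pderivSeq {q : ℕ} : List (Fin q) → (Euc q → ℝ) → (Euc q → ℝ)
  | [], f => f
  | i :: l, f => pderivSeq l fun x => fderiv ℝ f x (EuclideanSpace.single i 1)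

/-- The partial derivative `D^α` of multi-order `α`. -/
def Dmulti {q : ℕ} (α : Fin q → ℕ) (f : Euc q → ℝ) : Euc q → ℝ :=
  pderivSeq ((List.finRange q).flatMap fun i => List.replicate (α i) i) f


/-- The discrete measure `∑ᵢ pᵢ δ_{θᵢ}` with weights `z.1` and (possibly repeated) atoms `z.2`. -/
def mixOf {q k : ℕ} (z : (Fin k → ℝ) × (Fin k → Euc q)) : Euc q →₀ ℝ :=
  ∑ i, Finsupp.single (z.2 i) (z.1 i)

/-- Admissible parameters for measures with at most `k` atoms in `Θ`. -/
def mixParam {q : ℕ} (Θ : Set (Euc q)) (k : ℕ) : Set ((Fin k → ℝ) × (Fin k → Euc q)) :=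
  stdSimplex ℝ (Fin k) ×ˢ Set.univ.pi fun _ => Θ

lemma isCompact_mixParam {q : ℕ} {Θ : Set (Euc q)} (hΘ : IsCompact Θ) (k : ℕ) :
    IsCompact (mixParam Θ k) :=
  (isCompact_stdSimplex ℝ (Fin k)).prod (isCompact_univ_pi fun _ => hΘ)

lemma mixInt_mixOf {q k : ℕ} (z : (Fin k → ℝ) × (Fin k → Euc q)) (φ : Euc q → ℝ) :
    mixInt (mixOf z) φ = ∑ i, z.1 i * φ (z.2 i) := by
  change (mixOf z).sum (fun x a => a * φ x) = _
  rw [mixOf, ← Finsupp.sum_finsetSum_index (by simp) (by intros; ring)]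
  simp

open Classical in
lemma mixOf_apply {q k : ℕ} (z : (Fin k → ℝ) × (Fin k → Euc q)) (x : Euc q) :
    mixOf z x = ∑ i, if z.2 i = x then z.1 i else 0 := by
  simp [mixOf, Finsupp.finsetSum_apply, Finsupp.single_apply]

lemma mixOf_nonneg {q k : ℕ} {Θ : Set (Euc q)} {z : (Fin k → ℝ) × (Fin k → Euc q)}
    (hz : z ∈ mixParam Θ k) (x : Euc q) : 0 ≤ mixOf z x := by
  classical
  rw [mixOf_apply]
  exact Finset.sum_nonneg fun i _ => by split_ifs <;> simp [hz.1.1 i]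

lemma weight_eq_zero_of_notMem_support {q k : ℕ} {Θ : Set (Euc q)}
    {z : (Fin k → ℝ) × (Fin k → Euc q)} (hz : z ∈ mixParam Θ k) {i : Fin k}
    (hi : z.2 i ∉ (mixOf z).support) : z.1 i = 0 := by
  classical
  rw [Finsupp.notMem_support_iff, mixOf_apply,
    Finset.sum_eq_zero_iff_of_nonneg fun j _ => by split_ifs <;> simp [hz.1.1 j]] at hi
  simpa using hi i (Finset.mem_univ i)

lemma support_mixOf_subset {q k : ℕ} [DecidableEq (Euc q)]
    (z : (Fin k → ℝ) × (Fin k → Euc q)) :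
    (mixOf z).support ⊆ Finset.univ.image z.2 := by
  classical
  intro x hx
  rw [Finsupp.mem_support_iff, mixOf_apply] at hx
  obtain ⟨i, -, hi⟩ := Finset.exists_ne_zero_of_sum_ne_zero hx
  exact Finset.mem_image.2 ⟨i, Finset.mem_univ i, by by_contra h; simp [h] at hi⟩

lemma mixG_mixOf {q k : ℕ} {Θ : Set (Euc q)} {z : (Fin k → ℝ) × (Fin k → Euc q)}
    (hz : z ∈ mixParam Θ k) : MixG Θ k (mixOf z) := by
  classical
  refine ⟨⟨fun x hx => ?_, ?_, fun x hx => ?_⟩, ?_⟩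
  · exact lt_of_le_of_ne (mixOf_nonneg hz x) (Finsupp.mem_support_iff.1 hx).symm
  · simpa [mixInt, hz.1.2] using mixInt_mixOf z fun _ => 1
  · obtain ⟨i, -, rfl⟩ := Finset.mem_image.1 (support_mixOf_subset z hx)
    exact hz.2 i trivial
  · exact (Finset.card_le_card (support_mixOf_subset z)).trans
      (Finset.card_image_le.trans (by simp))

lemma exists_mixOf_eq {q k : ℕ} {Θ : Set (Euc q)} {G : Euc q →₀ ℝ} (hG : MixG Θ k G) :
    ∃ z ∈ mixParam Θ k, mixOf z = G := by
  classical
  obtain ⟨⟨hpos, hsum, hsub⟩, hcard⟩ := hG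
  have : Nonempty G.support := by
    rw [Finset.nonempty_coe_sort, Finset.nonempty_iff_ne_empty]
    intro h
    simp [h] at hsum
  obtain ⟨g⟩ : Nonempty (G.support ↪ Fin k) :=
    Function.Embedding.nonempty_of_card_le (by simpa using hcard)
  set θ : Fin k → G.support := Function.invFun g
  have hθ : ∀ x, θ (g x) = x := Function.leftInverse_invFun g.injective
  set z : (Fin k → ℝ) × (Fin k → Euc q) :=
    (fun i => if g (θ i) = i then G (θ i) else 0, fun i => θ i) with hz
  have hGz : mixOf z = G := by
    conv_rhs => rw [← Finsupp.sum_single G]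
    rw [mixOf, Finsupp.sum, ← Finset.sum_coe_sort G.support]
    symm
    refine Finset.sum_of_injOn g g.injective.injOn (by simp) ?_ ?_
    · intro i _ hi
      have : g (θ i) ≠ i := fun h => hi ⟨θ i, by simp, h⟩
      simp [hz, this]
    · intro x _
      simp [hz, hθ]
  refine ⟨z, ⟨⟨fun i => ?_, ?_⟩, fun i _ => hsub (θ i).2⟩, hGz⟩
  · simp only [hz]
    split_ifs
    · exact (hpos _ (θ i).2).le
    · exact le_rfl
  · have := mixInt_mixOf z fun _ => 1
    rw [hGz] at this
    simpa [mixInt, hsum] using this.symm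

lemma cost_nonneg {q : ℕ} (ℓ : ℝ) {G H : Euc q →₀ ℝ} {π : Euc q × Euc q → ℝ}
    (hπ : IsCoupling G H π) :
    0 ≤ ∑ p ∈ G.support ×ˢ H.support, π p * ‖p.1 - p.2‖ ^ ℓ :=
  Finset.sum_nonneg fun p _ => mul_nonneg (hπ.1 p) (Real.rpow_nonneg (norm_nonneg _) _)

lemma Wpow_le_cost {q : ℕ} (ℓ : ℝ) {G H : Euc q →₀ ℝ} {π : Euc q × Euc q → ℝ}
    (hπ : IsCoupling G H π) :
    Wpow ℓ G H ≤ ∑ p ∈ G.support ×ˢ H.support, π p * ‖p.1 - p.2‖ ^ ℓ :=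
  csInf_le ⟨0, by rintro _ ⟨π', h, rfl⟩; exact cost_nonneg ℓ h⟩ ⟨π, hπ, rfl⟩

lemma Wpow_nonneg {q : ℕ} (ℓ : ℝ) (G H : Euc q →₀ ℝ) : 0 ≤ Wpow ℓ G H :=
  Real.sInf_nonneg (by rintro _ ⟨π, h, rfl⟩; exact cost_nonneg ℓ h)

lemma isCoupling_prod {q : ℕ} {Θ : Set (Euc q)} {G H : Euc q →₀ ℝ}
    (hG : IsMixingMeasure Θ G) (hH : IsMixingMeasure Θ H) :
    IsCoupling G H fun p => G p.1 * H p.2 := by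
  have nonneg : ∀ {F : Euc q →₀ ℝ}, IsMixingMeasure Θ F → ∀ x, 0 ≤ F x := fun {F} hF x => by
    by_cases hx : x ∈ F.support
    · exact (hF.1 x hx).le
    · rw [Finsupp.notMem_support_iff.1 hx]
  refine ⟨fun p => mul_nonneg (nonneg hG _) (nonneg hH _), fun x _ => ?_, fun y _ => ?_⟩
  · simp only
    rw [← Finset.mul_sum, hH.2.1, mul_one]
  · simp only
    rw [← Finset.sum_mul, hG.2.1, one_mul]

lemma sum_coupling {q : ℕ} {Θ : Set (Euc q)} {G H : Euc q →₀ ℝ} {π : Euc q × Euc q → ℝ}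
    (hG : IsMixingMeasure Θ G) (hπ : IsCoupling G H π) :
    ∑ p ∈ G.support ×ˢ H.support, π p = 1 := by
  rw [Finset.sum_product, Finset.sum_congr rfl hπ.2.1, hG.2.1]

lemma Wpow_le_of_norm_le {q : ℕ} {Θ : Set (Euc q)} {G H : Euc q →₀ ℝ} {D ℓ : ℝ} (hℓ : 0 ≤ ℓ)
    (hD : ∀ x ∈ Θ, ∀ y ∈ Θ, ‖x - y‖ ≤ D)
    (hG : IsMixingMeasure Θ G) (hH : IsMixingMeasure Θ H) : Wpow ℓ G H ≤ D ^ ℓ := by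
  have hπ := isCoupling_prod hG hH
  refine (Wpow_le_cost ℓ hπ).trans ?_
  rw [← one_mul (D ^ ℓ), ← sum_coupling hG hπ, Finset.sum_mul]
  refine Finset.sum_le_sum fun p hp => mul_le_mul_of_nonneg_left ?_ (hπ.1 p)
  rw [Finset.mem_product] at hp
  exact Real.rpow_le_rpow (norm_nonneg _) (hD _ (hG.2.2 hp.1) _ (hH.2.2 hp.2)) hℓ

lemma Wpow_add_le {q : ℕ} {Θ : Set (Euc q)} {G H : Euc q →₀ ℝ} {D : ℝ} (m n : ℕ)
    (hD : ∀ x ∈ Θ, ∀ y ∈ Θ, ‖x - y‖ ≤ D)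
    (hG : IsMixingMeasure Θ G) (hH : IsMixingMeasure Θ H) :
    Wpow ((m + n : ℕ) : ℝ) G H ≤ D ^ m * Wpow (n : ℝ) G H := by
  have hD0 : 0 ≤ D := by
    obtain ⟨x, hx⟩ : G.support.Nonempty := by
      rw [Finset.nonempty_iff_ne_empty]
      intro h
      simpa [h] using hG.2.1
    simpa using hD x (hG.2.2 hx) x (hG.2.2 hx)
  rw [Wpow, Wpow, ← smul_eq_mul,
    ← Real.sInf_smul_of_nonneg (pow_nonneg hD0 m)]
  refine le_csInf (Set.Nonempty.smul_set ⟨_, _, isCoupling_prod hG hH, rfl⟩) ?_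
  rintro _ ⟨_, ⟨π, hπ, rfl⟩, rfl⟩
  refine (Wpow_le_cost _ hπ).trans ?_
  simp only [smul_eq_mul, Finset.mul_sum]
  refine Finset.sum_le_sum fun p hp => ?_
  rw [Finset.mem_product] at hp
  rw [Real.rpow_natCast, Real.rpow_natCast, pow_add, mul_left_comm]
  have := pow_le_pow_left₀ (norm_nonneg _) (hD _ (hG.2.2 hp.1) _ (hH.2.2 hp.2)) m
  exact mul_le_mul_of_nonneg_right this (mul_nonneg (hπ.1 p) (by positivity))

lemma Wpow_mixOf_le {q k : ℕ} {Θ : Set (Euc q)} {z w : (Fin k → ℝ) × (Fin k → Euc q)} (ℓ : ℝ)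
    (hz : z ∈ mixParam Θ k) (hw : w ∈ mixParam Θ k) {Q : Fin k → Fin k → ℝ}
    (hQ : ∀ i j, 0 ≤ Q i j) (hQz : ∀ i, ∑ j, Q i j = z.1 i) (hQw : ∀ j, ∑ i, Q i j = w.1 j) :
    Wpow ℓ (mixOf z) (mixOf w) ≤ ∑ i, ∑ j, Q i j * ‖z.2 i - w.2 j‖ ^ ℓ := by
  classical
  have hzero_left : ∀ i j, z.2 i ∉ (mixOf z).support → Q i j = 0 := fun i j hi =>
    (Finset.sum_eq_zero_iff_of_nonneg fun j _ => hQ i j).1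
      ((hQz i).trans (weight_eq_zero_of_notMem_support hz hi)) j (Finset.mem_univ j)
  have hzero_right : ∀ i j, w.2 j ∉ (mixOf w).support → Q i j = 0 := fun i j hj =>
    (Finset.sum_eq_zero_iff_of_nonneg fun i _ => hQ i j).1
      ((hQw j).trans (weight_eq_zero_of_notMem_support hw hj)) i (Finset.mem_univ i)
  set π : Euc q × Euc q → ℝ := fun p =>
    ∑ i, ∑ j, if z.2 i = p.1 then (if w.2 j = p.2 then Q i j else 0) else 0 with hπdef
  have hπ : IsCoupling (mixOf z) (mixOf w) π := by
    refine ⟨fun p => Finset.sum_nonneg fun i _ => Finset.sum_nonneg fun j _ => ?_,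
      fun x _ => ?_, fun y _ => ?_⟩
    · split_ifs <;> simp [hQ i j]
    · rw [mixOf_apply, hπdef, Finset.sum_comm]
      refine Finset.sum_congr rfl fun i _ => ?_
      rw [Finset.sum_comm]
      split_ifs with h
      · rw [← hQz i]
        refine Finset.sum_congr rfl fun j _ => ?_
        rw [Finset.sum_ite_eq]
        split_ifs with h'
        · rfl
        · exact (hzero_right i j h').symm
      · simp
    · rw [mixOf_apply, hπdef, Finset.sum_comm]
      simp_rw [Finset.sum_comm (s := (mixOf z).support)]
      rw [Finset.sum_comm]
      refine Finset.sum_congr rfl fun j _ => ?_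
      split_ifs with h
      · rw [← hQw j]
        refine Finset.sum_congr rfl fun i _ => ?_
        rw [Finset.sum_ite_eq]
        split_ifs with h'
        · rfl
        · exact (hzero_left i j h').symm
      · simp
  refine (Wpow_le_cost ℓ hπ).trans (le_of_eq ?_)
  simp only [hπdef, Finset.sum_mul]
  rw [Finset.sum_comm]
  refine Finset.sum_congr rfl fun i _ => ?_
  rw [Finset.sum_comm]
  refine Finset.sum_congr rfl fun j _ => ?_
  rw [Finset.sum_product]
  by_cases hi : z.2 i ∈ (mixOf z).support
  · by_cases hj : w.2 j ∈ (mixOf w).support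
    · rw [Finset.sum_eq_single_of_mem _ hi fun x _ hx => by simp [hx.symm],
        Finset.sum_eq_single_of_mem _ hj fun y _ hy => by simp [hy.symm]]
      simp
    · simp [hzero_right i j hj]
  · simp [hzero_left i j hi]

/-- The cost of the plan that keeps as much mass as possible on equally indexed atoms and moves
the remaining mass at distance at most `D`. -/
def matchCost {q k : ℕ} (D : ℝ) (w z : (Fin k → ℝ) × (Fin k → Euc q)) : ℝ :=
  (∑ i, min (z.1 i) (w.1 i) * ‖z.2 i - w.2 i‖) + (1 - ∑ i, min (z.1 i) (w.1 i)) * D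

lemma Wpow_one_mixOf_le {q k : ℕ} {Θ : Set (Euc q)} {z w : (Fin k → ℝ) × (Fin k → Euc q)}
    {D : ℝ} (hD : ∀ x ∈ Θ, ∀ y ∈ Θ, ‖x - y‖ ≤ D)
    (hz : z ∈ mixParam Θ k) (hw : w ∈ mixParam Θ k) :
    Wpow 1 (mixOf z) (mixOf w) ≤ matchCost D w z := by
  classical
  set m : Fin k → ℝ := fun i => min (z.1 i) (w.1 i) with hm
  set s : ℝ := 1 - ∑ i, m i with hs
  have hza : ∀ i, 0 ≤ z.1 i - m i := fun i => sub_nonneg.2 (min_le_left _ _)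
  have hwa : ∀ i, 0 ≤ w.1 i - m i := fun i => sub_nonneg.2 (min_le_right _ _)
  have hzs : ∑ i, (z.1 i - m i) = s := by rw [Finset.sum_sub_distrib, hz.1.2]
  have hws : ∑ i, (w.1 i - m i) = s := by rw [Finset.sum_sub_distrib, hw.1.2]
  have hs0 : 0 ≤ s := hzs ▸ Finset.sum_nonneg fun i _ => hza i
  have cancel : ∀ a : Fin k → ℝ, (∀ i, 0 ≤ a i) → ∑ i, a i = s → ∀ i, a i * s / s = a i := by
    intro a ha has i
    by_cases h : s = 0
    · rw [h, Finset.sum_eq_zero_iff_of_nonneg fun i _ => ha i] at has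
      simp [has i (Finset.mem_univ i)]
    · exact mul_div_cancel_right₀ _ h
  set R : Fin k → Fin k → ℝ := fun i j => (z.1 i - m i) * (w.1 j - m j) / s with hR
  have hR0 : ∀ i j, 0 ≤ R i j := fun i j => div_nonneg (mul_nonneg (hza i) (hwa j)) hs0
  have hRz : ∀ i, ∑ j, R i j = z.1 i - m i := fun i => by
    rw [hR, ← Finset.sum_div, ← Finset.mul_sum, hws, cancel _ hza hzs]
  have hRw : ∀ j, ∑ i, R i j = w.1 j - m j := fun j => by
    rw [hR, ← Finset.sum_div, ← Finset.sum_mul, hzs, mul_comm, cancel _ hwa hws]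
  refine (Wpow_mixOf_le 1 hz hw (Q := fun i j => (if i = j then m i else 0) + R i j)
    (fun i j => ?_) (fun i => ?_) (fun j => ?_)).trans ?_
  · refine add_nonneg ?_ (hR0 i j)
    split_ifs
    · exact le_min (hz.1.1 i) (hw.1.1 i)
    · exact le_rfl
  · simp [Finset.sum_add_distrib, hRz]
  · simp [Finset.sum_add_distrib, hRw]
  · simp only [add_mul, Finset.sum_add_distrib, ite_mul, zero_mul, Finset.sum_ite_eq,
      Finset.mem_univ, if_true, Real.rpow_one, matchCost]
    refine add_le_add le_rfl ?_
    change _ ≤ s * D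
    rw [← hzs, Finset.sum_mul]
    refine Finset.sum_le_sum fun i _ => ?_
    rw [← hRz i, Finset.sum_mul]
    exact Finset.sum_le_sum fun j _ =>
      mul_le_mul_of_nonneg_left (hD _ (hz.2 i trivial) _ (hw.2 j trivial)) (hR0 i j)

lemma eventually_Wpow_one_mixOf_le {q k : ℕ} {Θ : Set (Euc q)}
    {w : (Fin k → ℝ) × (Fin k → Euc q)} {D r : ℝ} (hD : ∀ x ∈ Θ, ∀ y ∈ Θ, ‖x - y‖ ≤ D)
    (hw : w ∈ mixParam Θ k) (hr : 0 < r) :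
    ∀ᶠ z in nhdsWithin w (mixParam Θ k), Wpow 1 (mixOf z) (mixOf w) ≤ r := by
  have hcont : Continuous (matchCost D w) := by
    unfold matchCost
    fun_prop
  have hself : matchCost D w w = 0 := by simp [matchCost, hw.1.2]
  have := hcont.continuousAt.eventually_lt (continuousAt_const (y := r)) (by rwa [hself])
  filter_upwards [nhdsWithin_le_nhds this, self_mem_nhdsWithin] with z hzr hz
  exact (Wpow_one_mixOf_le hD hz hw).trans hzr.le

lemma continuousOn_mixInt_mixOf {q : ℕ} {Θ : Set (Euc q)} {φ : Euc q → ℝ}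
    (hφ : ContinuousOn φ Θ) (k : ℕ) :
    ContinuousOn (fun z => mixInt (mixOf z) φ) (mixParam Θ k) := by
  simp only [mixInt_mixOf]
  refine continuousOn_finsetSum _ fun i _ => ContinuousOn.mul (by fun_prop) ?_
  exact hφ.comp (by fun_prop) fun z hz => hz.2 i trivial

lemma ofReal_abs_le_phiDist {q : ℕ} {Φ : Set (Euc q → ℝ)} {φ : Euc q → ℝ} (hφ : φ ∈ Φ)
    (G H : Euc q →₀ ℝ) : ENNReal.ofReal |mixInt G φ - mixInt H φ| ≤ phiDist Φ G H :=
  le_iSup₂ (f := fun φ (_ : φ ∈ Φ) => ENNReal.ofReal |mixInt G φ - mixInt H φ|) φ hφ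

/-- the local inverse bounds at every `G0 ∈ E_{k0}(Θ)`, together with
distinguishability, imply the global inverse bound on `G_k(Θ)`. -/
theorem global_inverse_bound_of_local {q k : ℕ} (hk : 1 ≤ k)
    (Θ : Set (Euc q)) (hΘ : IsCompact Θ)
    (Φ : Set (Euc q → ℝ)) (hcont : ∀ φ ∈ Φ, ContinuousOn φ Θ)
    (hdist : ∀ G H : Euc q →₀ ℝ, MixG Θ k G → MixG Θ k H → G ≠ H → 0 < phiDist Φ G H)
    (hloc : ∀ k0 : ℕ, 1 ≤ k0 → k0 ≤ k → ∀ G0 : Euc q →₀ ℝ, MixE Θ k0 G0 →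
      ∃ r > (0:ℝ), ∃ c > (0:ℝ), ∀ G H : Euc q →₀ ℝ,
        MixG Θ k G → MixG Θ k H → G ≠ H →
        Wpow 1 G G0 ≤ r → Wpow 1 H G0 ≤ r →
        ENNReal.ofReal (c * Wpow ((2 * (k - k0 + 1) - 1 : ℕ) : ℝ) G H) ≤ phiDist Φ G H) :
    ∃ c' > (0:ℝ), ∀ G H : Euc q →₀ ℝ, MixG Θ k G → MixG Θ k H → G ≠ H →
      ENNReal.ofReal (c' * Wpow ((2 * k - 1 : ℕ) : ℝ) G H) ≤ phiDist Φ G H := by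
  obtain ⟨D, hD1, hD⟩ : ∃ D ≥ (1:ℝ), ∀ x ∈ Θ, ∀ y ∈ Θ, ‖x - y‖ ≤ D := by
    obtain ⟨C, hC⟩ := Metric.isBounded_iff.1 hΘ.isBounded
    exact ⟨max 1 C, le_max_left _ _, fun x hx y hy =>
      (dist_eq_norm x y ▸ hC hx hy).trans (le_max_right _ _)⟩
  have hD0 : 0 < D := by linarith
  set K := mixParam Θ k with hK
  suffices h : ∃ c' > (0:ℝ), ∀ z ∈ K ×ˢ K, mixOf z.1 ≠ mixOf z.2 →
      ENNReal.ofReal (c' * Wpow ((2 * k - 1 : ℕ) : ℝ) (mixOf z.1) (mixOf z.2)) ≤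
        phiDist Φ (mixOf z.1) (mixOf z.2) by
    obtain ⟨c', hc', h⟩ := h
    refine ⟨c', hc', fun G H hG hH hne => ?_⟩
    obtain ⟨z, hz, rfl⟩ := exists_mixOf_eq hG
    obtain ⟨w, hw, rfl⟩ := exists_mixOf_eq hH
    exact h (z, w) ⟨hz, hw⟩ hne
  refine ((isCompact_mixParam hΘ k).prod (isCompact_mixParam hΘ k)).induction_on
    (p := fun S => ∃ c' > (0:ℝ), ∀ z ∈ S, mixOf z.1 ≠ mixOf z.2 →
      ENNReal.ofReal (c' * Wpow ((2 * k - 1 : ℕ) : ℝ) (mixOf z.1) (mixOf z.2)) ≤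
        phiDist Φ (mixOf z.1) (mixOf z.2)) ?_ ?_ ?_ ?_
  · exact ⟨1, one_pos, by simp⟩
  · rintro S T hST ⟨c, hc, h⟩
    exact ⟨c, hc, fun z hz => h z (hST hz)⟩
  · rintro S T ⟨c, hc, hS⟩ ⟨d, hd, hT⟩
    refine ⟨min c d, lt_min hc hd, fun z hz hne => ?_⟩
    rcases hz with hz | hz
    · refine le_trans (ENNReal.ofReal_le_ofReal ?_) (hS z hz hne)
      exact mul_le_mul_of_nonneg_right (min_le_left _ _) (Wpow_nonneg _ _ _)
    · refine le_trans (ENNReal.ofReal_le_ofReal ?_) (hT z hz hne)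
      exact mul_le_mul_of_nonneg_right (min_le_right _ _) (Wpow_nonneg _ _ _)
  rintro ⟨u, v⟩ ⟨hu, hv⟩
  have hfst : Filter.Tendsto Prod.fst (nhdsWithin (u, v) (K ×ˢ K)) (nhdsWithin u K) := by
    rw [nhdsWithin_prod_eq]; exact Filter.tendsto_fst
  have hsnd : Filter.Tendsto Prod.snd (nhdsWithin (u, v) (K ×ˢ K)) (nhdsWithin v K) := by
    rw [nhdsWithin_prod_eq]; exact Filter.tendsto_snd
  by_cases huv : mixOf u = mixOf v
  · have hGu := mixG_mixOf hu
    have hcard : 1 ≤ (mixOf u).support.card := by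
      rw [Nat.one_le_iff_ne_zero, Finset.card_ne_zero, Finset.nonempty_iff_ne_empty]
      intro h
      simpa [h] using hGu.1.2.1
    obtain ⟨r, hr, c, hc, hbound⟩ := hloc _ hcard hGu.2 (mixOf u) ⟨hGu.1, rfl⟩
    set k0 := (mixOf u).support.card
    have hk0 : k0 ≤ k := hGu.2
    have hexp : 2 * k - 1 = 2 * (k0 - 1) + (2 * (k - k0 + 1) - 1) := by omega
    refine ⟨_, Filter.inter_mem
      (Filter.inter_mem (hfst.eventually (eventually_Wpow_one_mixOf_le hD hu hr))
        (hsnd.eventually (eventually_Wpow_one_mixOf_le hD hv hr))) self_mem_nhdsWithin,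
      c / D ^ (2 * (k0 - 1)), by positivity, ?_⟩
    rintro ⟨z, w⟩ ⟨⟨hzr, hwr⟩, hz, hw⟩ hne
    have hG := mixG_mixOf hz
    have hH := mixG_mixOf hw
    refine le_trans (ENNReal.ofReal_le_ofReal ?_) (hbound _ _ hG hH hne hzr (huv ▸ hwr))
    rw [hexp, div_mul_eq_mul_div, div_le_iff₀ (by positivity), mul_assoc]
    refine mul_le_mul_of_nonneg_left ?_ hc.le
    rw [mul_comm (Wpow _ _ _)]
    exact Wpow_add_le _ _ hD hG.1 hH.1
  · have hpos := hdist _ _ (mixG_mixOf hu) (mixG_mixOf hv) huv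
    simp only [phiDist, lt_iSup_iff, ENNReal.ofReal_pos] at hpos
    obtain ⟨φ, hφ, hpos⟩ := hpos
    have hcontφ := continuousOn_mixInt_mixOf (hcont φ hφ) k
    have hlim : Filter.Tendsto
        (fun z : _ × _ => |mixInt (mixOf z.1) φ - mixInt (mixOf z.2) φ|)
        (nhdsWithin (u, v) (K ×ˢ K)) (nhds |mixInt (mixOf u) φ - mixInt (mixOf v) φ|) :=
      (((hcontφ u hu).tendsto.comp hfst).sub ((hcontφ v hv).tendsto.comp hsnd)).abs
    set δ := |mixInt (mixOf u) φ - mixInt (mixOf v) φ|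
    refine ⟨_, Filter.inter_mem (hlim.eventually (lt_mem_nhds (half_lt_self hpos)))
      self_mem_nhdsWithin, δ / 2 / D ^ ((2 * k - 1 : ℕ) : ℝ), by positivity, ?_⟩
    rintro ⟨z, w⟩ ⟨hzw, hz, hw⟩ -
    refine le_trans (ENNReal.ofReal_le_ofReal ?_) (ofReal_abs_le_phiDist hφ _ _)
    refine le_trans ?_ (le_of_lt hzw)
    rw [div_mul_eq_mul_div, div_le_iff₀ (by positivity)]
    exact mul_le_mul_of_nonneg_left (Wpow_le_of_norm_le (Nat.cast_nonneg _) hD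
      (mixG_mixOf hz).1 (mixG_mixOf hw).1) (by positivity)

end
end

section
/- Fix integers 1 ≤ k0 ≤ k and set d1 = k − k0 + 1, and fix G0 ∈ E_{k0}(Θ). Suppose Θ ⊆ ℝ^q is compact, every φ ∈ Φ is continuous on Θ, G_k(Θ) is distinguishable by Φ, and the local inverse bound holds at G0: there exist r0 > 0 and c0 > 0 such that sup_{φ∈Φ}|Gφ − Hφ| ≥ c0 · W_{2d1−1}(G,H)^{2d1−1} whenever G ≠ H ∈ G_k(Θ) satisfy W_1(G,G0) ≤ r0 and W_1(H,G0) ≤ r0. Then there exist r > 0 and C > 0 such that for every G ∈ G_k(Θ) with W_1(G0,G) < r, every Ĥ ∈ G_k(Θ), and every t > 0: if W_{2d1−1}(G,Ĥ)^{2d1−1} ≥ t, then sup_{φ∈Φ}|Gφ − Ĥφ| ≥ C · min(t,1). -/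
open scoped BigOperators ENNReal

noncomputable section

section Helpers

open Filter Topology Finset

variable {q : ℕ} {ι : Type*} [Fintype ι]

lemma IsMixingMeasure.nonneg {Θ : Set (Euc q)} {G : Euc q →₀ ℝ} (hG : IsMixingMeasure Θ G)
    (x : Euc q) : 0 ≤ G x := by
  by_cases hx : x ∈ G.support
  · exact (hG.1 x hx).le
  · rw [Finsupp.notMem_support_iff.mp hx]

lemma mixInt_eq_finsuppSum (G : Euc q →₀ ℝ) (φ : Euc q → ℝ) :
    mixInt G φ = G.sum fun x g => g * φ x := rfl

lemma transportCost_nonneg {G H : Euc q →₀ ℝ} {π : Euc q × Euc q → ℝ} (hπ : IsCoupling G H π)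
    (ℓ : ℝ) : 0 ≤ ∑ p ∈ G.support ×ˢ H.support, π p * ‖p.1 - p.2‖ ^ ℓ :=
  Finset.sum_nonneg fun p _ => mul_nonneg (hπ.1 p) (Real.rpow_nonneg (norm_nonneg _) _)

lemma Wpow_le_of_isCoupling {G H : Euc q →₀ ℝ} {π : Euc q × Euc q → ℝ} (hπ : IsCoupling G H π)
    (ℓ : ℝ) : Wpow ℓ G H ≤ ∑ p ∈ G.support ×ˢ H.support, π p * ‖p.1 - p.2‖ ^ ℓ := by
  refine csInf_le ⟨0, ?_⟩ ⟨π, hπ, rfl⟩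
  rintro c ⟨π', hπ', rfl⟩
  exact transportCost_nonneg hπ' ℓ

lemma IsCoupling.swap {G H : Euc q →₀ ℝ} {π : Euc q × Euc q → ℝ} (hπ : IsCoupling G H π) :
    IsCoupling H G (π ∘ Prod.swap) :=
  ⟨fun p => hπ.1 p.swap, fun x hx => hπ.2.2 x hx, fun y hy => hπ.2.1 y hy⟩

lemma isCoupling_mul {Θ : Set (Euc q)} {G H : Euc q →₀ ℝ} (hG : IsMixingMeasure Θ G)
    (hH : IsMixingMeasure Θ H) : IsCoupling G H fun p => G p.1 * H p.2 := by
  refine ⟨fun p => mul_nonneg (hG.nonneg _) (hH.nonneg _), fun x _ => ?_, fun y _ => ?_⟩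
  · dsimp only
    rw [← Finset.mul_sum, hH.2.1, mul_one]
  · dsimp only
    rw [← Finset.sum_mul, hG.2.1, one_mul]

lemma Wpow_comm (ℓ : ℝ) (G H : Euc q →₀ ℝ) : Wpow ℓ G H = Wpow ℓ H G := by
  have key : ∀ G H : Euc q →₀ ℝ, ∀ π : Euc q × Euc q → ℝ,
      ∑ p ∈ G.support ×ˢ H.support, π p * ‖p.1 - p.2‖ ^ ℓ =
        ∑ p ∈ H.support ×ˢ G.support, (π ∘ Prod.swap) p * ‖p.1 - p.2‖ ^ ℓ := by
    intro G H π
    rw [Finset.sum_product, Finset.sum_product_right]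
    simp [norm_sub_rev]
  unfold Wpow
  congr 1
  ext c
  constructor
  · rintro ⟨π, hπ, rfl⟩
    exact ⟨_, hπ.swap, key G H π⟩
  · rintro ⟨π, hπ, rfl⟩
    exact ⟨_, hπ.swap, key H G π⟩

lemma Wpow_self_nonpos {Θ : Set (Euc q)} {G : Euc q →₀ ℝ} (hG : IsMixingMeasure Θ G)
    {ℓ : ℝ} (hℓ : ℓ ≠ 0) : Wpow ℓ G G ≤ 0 := by
  classical
  have hπ : IsCoupling G G fun p => if p.1 = p.2 then G p.1 else 0 := by
    refine ⟨fun p => ?_, fun x hx => ?_, fun y hy => ?_⟩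
    · dsimp only
      split_ifs
      exacts [hG.nonneg _, le_rfl]
    · simp only [Finset.sum_ite_eq, if_pos hx]
    · simp only [Finset.sum_ite_eq', if_pos hy]
  refine (Wpow_le_of_isCoupling hπ ℓ).trans (Finset.sum_eq_zero fun p _ => ?_).le
  split_ifs with h
  · simp [h, Real.zero_rpow hℓ]
  · simp

/-- The easy half of Kantorovich duality. -/
lemma abs_mixInt_sub_le_Wpow_one {Θ : Set (Euc q)} {G H : Euc q →₀ ℝ} (hG : IsMixingMeasure Θ G)
    (hH : IsMixingMeasure Θ H) {φ : Euc q → ℝ} (hφ : ∀ x y, |φ x - φ y| ≤ ‖x - y‖) :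
    |mixInt G φ - mixInt H φ| ≤ Wpow 1 G H := by
  refine le_csInf ⟨_, _, isCoupling_mul hG hH, rfl⟩ ?_
  rintro c ⟨π, hπ, rfl⟩
  have h1 : mixInt G φ = ∑ p ∈ G.support ×ˢ H.support, π p * φ p.1 := by
    rw [Finset.sum_product]
    refine Finset.sum_congr rfl fun x hx => ?_
    rw [← hπ.2.1 x hx, Finset.sum_mul]
  have h2 : mixInt H φ = ∑ p ∈ G.support ×ˢ H.support, π p * φ p.2 := by
    rw [Finset.sum_product_right]
    refine Finset.sum_congr rfl fun x hx => ?_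
    rw [← hπ.2.2 x hx, Finset.sum_mul]
  rw [h1, h2, ← Finset.sum_sub_distrib]
  refine (Finset.abs_sum_le_sum_abs _ _).trans (Finset.sum_le_sum fun p _ => ?_)
  rw [← mul_sub, abs_mul, abs_of_nonneg (hπ.1 p), Real.rpow_one]
  exact mul_le_mul_of_nonneg_left (hφ _ _) (hπ.1 p)

/-- Finitely supported measures are separated by `1`-Lipschitz functions. -/
lemma eq_of_forall_mixInt_eq {G H : Euc q →₀ ℝ}
    (h : ∀ φ : Euc q → ℝ, (∀ x y, |φ x - φ y| ≤ ‖x - y‖) → mixInt G φ = mixInt H φ) :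
    G = H := by
  classical
  ext a
  have hfin : ((((G.support ∪ H.support).erase a : Finset (Euc q)) : Set (Euc q))ᶜ) ∈ 𝓝 a :=
    (Finset.finite_toSet _).isClosed.isOpen_compl.mem_nhds (by simp)
  obtain ⟨δ, hδ, hball⟩ := Metric.mem_nhds_iff.mp hfin
  have hval : ∀ F : Euc q →₀ ℝ, F.support ⊆ G.support ∪ H.support →
      mixInt F (fun z => max 0 (δ - dist z a)) = F a * δ := by
    intro F hF
    unfold mixInt
    rw [Finset.sum_eq_single a]
    · simp [hδ.le]
    · intro b hb hba
      have : δ ≤ dist b a := by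
        by_contra! hlt
        exact hball (Metric.mem_ball.mpr hlt) (by simpa [hba] using hF hb)
      exact mul_eq_zero_of_right _ (max_eq_left (by linarith))
    · intro ha
      simp [Finsupp.notMem_support_iff.mp ha]
  have := h (fun z => max 0 (δ - dist z a)) fun x y => by
    refine (abs_max_sub_max_le_max _ _ _ _).trans ?_
    rw [sub_self, abs_zero, max_eq_right (abs_nonneg _), ← dist_eq_norm]
    rw [show δ - dist x a - (δ - dist y a) = -(dist x a - dist y a) by ring, abs_neg]
    exact abs_dist_sub_le x y a
  rw [hval G Finset.subset_union_left, hval H Finset.subset_union_right] at this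
  exact mul_right_cancel₀ hδ.ne' this

/-- The signed measure `∑ᵢ pᵢ δ_{θᵢ}`. -/
def ofAtoms (p : ι → ℝ) (θ : ι → Euc q) : Euc q →₀ ℝ := ∑ i, Finsupp.single (θ i) (p i)

lemma mixInt_ofAtoms (p : ι → ℝ) (θ : ι → Euc q) (φ : Euc q → ℝ) :
    mixInt (ofAtoms p θ) φ = ∑ i, p i * φ (θ i) := by
  rw [mixInt_eq_finsuppSum, ofAtoms, ← Finsupp.sum_finsetSum_index]
  · simp
  · simp
  · intros; ring

lemma ofAtoms_apply [DecidableEq (Euc q)] (p : ι → ℝ) (θ : ι → Euc q) (a : Euc q) :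
    ofAtoms p θ a = ∑ i, if θ i = a then p i else 0 := by
  simp [ofAtoms, Finsupp.finsetSum_apply, Finsupp.single_apply]

lemma support_ofAtoms_subset [DecidableEq (Euc q)] (p : ι → ℝ) (θ : ι → Euc q) :
    (ofAtoms p θ).support ⊆ Finset.univ.image θ := by
  intro a ha
  by_contra hna
  refine Finsupp.mem_support_iff.mp ha ?_
  rw [ofAtoms_apply]
  exact Finset.sum_eq_zero fun i _ => if_neg fun h => hna (by simp [← h])

lemma mem_support_ofAtoms {p : ι → ℝ} (hp : ∀ i, 0 ≤ p i) (θ : ι → Euc q) {i : ι}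
    (hi : p i ≠ 0) : θ i ∈ (ofAtoms p θ).support := by
  classical
  rw [Finsupp.mem_support_iff, ofAtoms_apply]
  refine (Finset.sum_pos' (fun j _ => ?_) ⟨i, Finset.mem_univ _, ?_⟩).ne'
  · split_ifs
    exacts [hp j, le_rfl]
  · simpa using lt_of_le_of_ne (hp i) hi.symm

lemma mixG_ofAtoms {Θ : Set (Euc q)} {p : ι → ℝ} {θ : ι → Euc q} (hp : p ∈ stdSimplex ℝ ι)
    (hθ : ∀ i, θ i ∈ Θ) : MixG Θ (Fintype.card ι) (ofAtoms p θ) := by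
  classical
  refine ⟨⟨fun x hx => ?_, ?_, fun x hx => ?_⟩, ?_⟩
  · refine lt_of_le_of_ne ?_ (Finsupp.mem_support_iff.mp hx).symm
    rw [ofAtoms_apply]
    refine Finset.sum_nonneg fun i _ => ?_
    split_ifs
    exacts [hp.1 i, le_rfl]
  · simpa [mixInt, hp.2] using mixInt_ofAtoms p θ fun _ => 1
  · obtain ⟨i, -, rfl⟩ := Finset.mem_image.mp (support_ofAtoms_subset p θ hx)
    exact hθ i
  · exact (Finset.card_le_card (support_ofAtoms_subset p θ)).trans Finset.card_image_le

lemma MixG.exists_ofAtoms {Θ : Set (Euc q)} {k : ℕ} {G : Euc q →₀ ℝ} (hG : MixG Θ k G) :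
    ∃ p ∈ stdSimplex ℝ (Fin k), ∃ θ : Fin k → Euc q, (∀ i, θ i ∈ Θ) ∧ ofAtoms p θ = G := by
  classical
  obtain ⟨⟨hpos, hsum, hsub⟩, hcard⟩ := hG
  obtain ⟨s, hs⟩ : G.support.Nonempty := by
    rw [Finset.nonempty_iff_ne_empty]
    intro h
    simp [h] at hsum
  obtain ⟨e⟩ : Nonempty (G.support ↪ Fin k) :=
    Function.Embedding.nonempty_of_card_le (by simpa using hcard)
  have hext : ∀ i, i ∉ Set.range e →
      Function.extend e (fun x : G.support => G x) 0 i = 0 := fun i hi => by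
    rw [Function.extend_apply' _ _ _ hi, Pi.zero_apply]
  refine ⟨Function.extend e (fun x : G.support => G x) 0, ⟨fun i => ?_, ?_⟩,
    Function.extend e (fun x : G.support => (x : Euc q)) fun _ => s, fun i => ?_, ?_⟩
  · by_cases hi : i ∈ Set.range e
    · obtain ⟨x, rfl⟩ := hi
      rw [e.injective.extend_apply]
      exact (hpos x x.2).le
    · exact (hext i hi).ge
  · rw [← Fintype.sum_of_injective e e.injective (fun x => G x) _ hext fun x => by
      rw [e.injective.extend_apply]]
    rw [← hsum]
    exact Finset.sum_coe_sort G.support fun x => G x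
  · by_cases hi : i ∈ Set.range e
    · obtain ⟨x, rfl⟩ := hi
      rw [e.injective.extend_apply]
      exact hsub x.2
    · rw [Function.extend_apply' _ _ _ hi]
      exact hsub hs
  · rw [ofAtoms, ← Fintype.sum_of_injective e e.injective
      (fun x => Finsupp.single (x : Euc q) (G x)) _ (fun i hi => by
        rw [hext i hi, Finsupp.single_zero]) fun x => by
        rw [e.injective.extend_apply, e.injective.extend_apply]]
    rw [Finset.sum_coe_sort G.support fun x => Finsupp.single x (G x)]
    exact G.sum_single

/-- A coupling of the weights bounds the transport cost between the measures they define. -/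
lemma Wpow_ofAtoms_le {κ : Type*} [Fintype κ] {p : ι → ℝ} {θ : ι → Euc q} {r : κ → ℝ}
    {η : κ → Euc q} {γ : ι → κ → ℝ} (hγ : ∀ i j, 0 ≤ γ i j) (hp : ∀ i, ∑ j, γ i j = p i)
    (hr : ∀ j, ∑ i, γ i j = r j) (ℓ : ℝ) :
    Wpow ℓ (ofAtoms p θ) (ofAtoms r η) ≤ ∑ i, ∑ j, γ i j * ‖θ i - η j‖ ^ ℓ := by
  classical
  have hp0 : ∀ i, 0 ≤ p i := fun i => hp i ▸ Finset.sum_nonneg fun j _ => hγ i j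
  have hr0 : ∀ j, 0 ≤ r j := fun j => hr j ▸ Finset.sum_nonneg fun i _ => hγ i j
  have hγp : ∀ i j, γ i j ≠ 0 → θ i ∈ (ofAtoms p θ).support := fun i j h =>
    mem_support_ofAtoms hp0 θ fun h0 => h <|
      (Finset.sum_eq_zero_iff_of_nonneg fun j _ => hγ i j).mp ((hp i).trans h0) j (mem_univ j)
  have hγr : ∀ i j, γ i j ≠ 0 → η j ∈ (ofAtoms r η).support := fun i j h =>
    mem_support_ofAtoms hr0 η fun h0 => h <|
      (Finset.sum_eq_zero_iff_of_nonneg fun i _ => hγ i j).mp ((hr j).trans h0) i (mem_univ i)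
  have hπ : IsCoupling (ofAtoms p θ) (ofAtoms r η)
      fun z => ∑ i, ∑ j, if θ i = z.1 ∧ η j = z.2 then γ i j else 0 := by
    refine ⟨fun z => Finset.sum_nonneg fun i _ => Finset.sum_nonneg fun j _ => ?_,
      fun x _ => ?_, fun y _ => ?_⟩
    · split_ifs
      exacts [hγ i j, le_rfl]
    · rw [ofAtoms_apply, Finset.sum_comm]
      refine Finset.sum_congr rfl fun i _ => ?_
      rw [Finset.sum_comm]
      by_cases hx : θ i = x
      · simp only [hx, true_and, if_true, ← hp i, Finset.sum_ite_eq]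
        refine Finset.sum_congr rfl fun j _ => ?_
        by_cases h : γ i j = 0
        · simp [h]
        · rw [if_pos (hγr i j h)]
      · simp [hx]
    · rw [ofAtoms_apply, Finset.sum_comm]
      simp_rw [Finset.sum_comm (s := (ofAtoms p θ).support)]
      rw [Finset.sum_comm]
      refine Finset.sum_congr rfl fun j _ => ?_
      by_cases hy : η j = y
      · simp only [hy, and_true, if_true, ← hr j, Finset.sum_ite_eq]
        refine Finset.sum_congr rfl fun i _ => ?_
        by_cases h : γ i j = 0
        · simp [h]
        · rw [if_pos (hγp i j h)]
      · simp [hy]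
  refine (Wpow_le_of_isCoupling hπ ℓ).trans (le_of_eq ?_)
  simp_rw [Finset.sum_mul]
  rw [Finset.sum_comm]
  refine Finset.sum_congr rfl fun i _ => ?_
  rw [Finset.sum_comm]
  refine Finset.sum_congr rfl fun j _ => ?_
  by_cases h : γ i j = 0
  · simp [h]
  rw [Finset.sum_eq_single (θ i, η j)]
  · simp
  · intro z _ hz
    rw [if_neg fun h' => hz (Prod.ext h'.1.symm h'.2.symm), zero_mul]
  · intro hz
    exact absurd (Finset.mem_product.mpr ⟨hγp i j h, hγr i j h⟩) hz

lemma Wpow_one_ofAtoms_le {p r : ι → ℝ} {θ η : ι → Euc q} (hp : p ∈ stdSimplex ℝ ι)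
    (hr : r ∈ stdSimplex ℝ ι) {ε D : ℝ} (hε0 : 0 ≤ ε) (hε1 : ε ≤ 1)
    (hpr : ∀ i, (1 - ε) * r i ≤ p i) (hθη : ∀ i, ‖θ i - η i‖ ≤ ε)
    (hD : ∀ i j, ‖θ i - η j‖ ≤ D) :
    Wpow 1 (ofAtoms p θ) (ofAtoms r η) ≤ ε * (1 + D) := by
  classical
  have hres : ∑ i, (p i - (1 - ε) * r i) = ε := by
    rw [Finset.sum_sub_distrib, ← Finset.mul_sum, hp.2, hr.2]
    ring
  refine (Wpow_ofAtoms_le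
    (γ := fun i j => (if i = j then (1 - ε) * r i else 0) + (p i - (1 - ε) * r i) * r j)
    (fun i j => ?_) (fun i => ?_) (fun j => ?_) 1).trans ?_
  · refine add_nonneg ?_ (mul_nonneg (sub_nonneg.mpr (hpr i)) (hr.1 j))
    split_ifs
    exacts [mul_nonneg (by linarith) (hr.1 i), le_rfl]
  · simp [Finset.sum_add_distrib, ← Finset.mul_sum, hr.2]
  · rw [Finset.sum_add_distrib, ← Finset.sum_mul, hres]
    simp only [Finset.sum_ite_eq', Finset.mem_univ, if_true]
    ring
  · simp only [Real.rpow_one, add_mul, Finset.sum_add_distrib, ite_mul, zero_mul,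
      Finset.sum_ite_eq, Finset.mem_univ, if_true]
    have h1 : ∑ i, (1 - ε) * r i * ‖θ i - η i‖ ≤ ∑ i, r i * ε :=
      Finset.sum_le_sum fun i _ => mul_le_mul (by nlinarith [hr.1 i]) (hθη i)
        (norm_nonneg _) (hr.1 i)
    have h2 : ∑ i, ∑ j, (p i - (1 - ε) * r i) * r j * ‖θ i - η j‖ ≤
        ∑ i, ∑ j, (p i - (1 - ε) * r i) * r j * D :=
      Finset.sum_le_sum fun i _ => Finset.sum_le_sum fun j _ =>
        mul_le_mul_of_nonneg_left (hD i j) (mul_nonneg (sub_nonneg.mpr (hpr i)) (hr.1 j))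
    simp only [← Finset.sum_mul, ← Finset.mul_sum, hr.2, hres] at h1 h2
    linarith

lemma tendsto_Wpow_one_ofAtoms {p : ℕ → ι → ℝ} {r : ι → ℝ} {θ : ℕ → ι → Euc q} {η : ι → Euc q}
    (hp : ∀ n, p n ∈ stdSimplex ℝ ι) (hr : r ∈ stdSimplex ℝ ι)
    (hpr : Tendsto p atTop (𝓝 r)) (hθη : Tendsto θ atTop (𝓝 η)) {ρ : ℝ} (hρ : 0 < ρ) :
    ∀ᶠ n in atTop, Wpow 1 (ofAtoms (p n) (θ n)) (ofAtoms r η) ≤ ρ := by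
  obtain ⟨D, hD⟩ : ∃ D, ∀ i j, ‖η i - η j‖ ≤ D := by
    obtain ⟨D, hD⟩ := (Set.finite_range fun z : ι × ι => ‖η z.1 - η z.2‖).bddAbove
    exact ⟨D, fun i j => hD ⟨(i, j), rfl⟩⟩
  obtain ⟨ε, hε, hε1, hερ⟩ : ∃ ε : ℝ, 0 < ε ∧ ε ≤ 1 ∧ ε * (1 + (1 + |D|)) ≤ ρ := by
    have h2 : 0 < 1 + (1 + |D|) := by positivity
    refine ⟨min 1 (ρ / (1 + (1 + |D|))), by positivity, min_le_left _ _, ?_⟩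
    rw [← le_div_iff₀ h2]
    exact min_le_right _ _
  have h1 : ∀ᶠ n in atTop, ∀ i, (1 - ε) * r i ≤ p n i := by
    refine eventually_all.mpr fun i => ?_
    rcases (hr.1 i).eq_or_lt with h0 | h0
    · exact Eventually.of_forall fun n => by rw [← h0]; simpa using (hp n).1 i
    · have : (1 - ε) * r i < r i := by nlinarith
      exact (((tendsto_pi_nhds.mp hpr i).eventually (lt_mem_nhds this))).mono fun n h => h.le
  have h2 : ∀ᶠ n in atTop, ∀ i, ‖θ n i - η i‖ ≤ ε := by
    refine eventually_all.mpr fun i => ?_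
    refine ((tendsto_pi_nhds.mp hθη i).eventually (Metric.closedBall_mem_nhds _ hε)).mono
      fun n h => ?_
    simpa [dist_eq_norm] using h
  filter_upwards [h1, h2] with n h1 h2
  refine (Wpow_one_ofAtoms_le (hp n) hr hε.le hε1 h1 h2 fun i j => ?_).trans hερ
  calc ‖θ n i - η j‖ = ‖(θ n i - η i) + (η i - η j)‖ := by rw [sub_add_sub_cancel]
    _ ≤ ‖θ n i - η i‖ + ‖η i - η j‖ := norm_add_le _ _
    _ ≤ 1 + |D| := add_le_add ((h2 i).trans hε1) ((hD i j).trans (le_abs_self D))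

lemma tendsto_mixInt_ofAtoms {Θ : Set (Euc q)} {p : ℕ → ι → ℝ} {r : ι → ℝ}
    {θ : ℕ → ι → Euc q} {η : ι → Euc q} (hθ : ∀ n i, θ n i ∈ Θ) (hη : ∀ i, η i ∈ Θ)
    (hpr : Tendsto p atTop (𝓝 r)) (hθη : Tendsto θ atTop (𝓝 η)) {φ : Euc q → ℝ}
    (hφ : ContinuousOn φ Θ) :
    Tendsto (fun n => mixInt (ofAtoms (p n) (θ n)) φ) atTop (𝓝 (mixInt (ofAtoms r η) φ)) := by
  simp only [mixInt_ofAtoms]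
  refine tendsto_finsetSum _ fun i _ => (tendsto_pi_nhds.mp hpr i).mul ?_
  exact (hφ (η i) (hη i)).tendsto.comp <| tendsto_nhdsWithin_iff.mpr
    ⟨tendsto_pi_nhds.mp hθη i, Eventually.of_forall fun n => hθ n i⟩

/-- Sequential compactness of `G_k(Θ)` for compact `Θ`. -/
lemma exists_subseq_tendsto_mixG {Θ : Set (Euc q)} (hΘ : IsCompact Θ) {k : ℕ}
    {G : ℕ → Euc q →₀ ℝ} (hG : ∀ n, MixG Θ k (G n)) :
    ∃ G' : Euc q →₀ ℝ, MixG Θ k G' ∧ ∃ s : ℕ → ℕ, StrictMono s ∧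
      (∀ φ : Euc q → ℝ, ContinuousOn φ Θ →
        Tendsto (fun n => mixInt (G (s n)) φ) atTop (𝓝 (mixInt G' φ))) ∧
      ∀ ρ > 0, ∀ᶠ n in atTop, Wpow 1 (G (s n)) G' ≤ ρ := by
  choose p hp θ hθ hpθ using fun n => (hG n).exists_ofAtoms
  have hK : IsCompact (stdSimplex ℝ (Fin k) ×ˢ Set.univ.pi fun _ : Fin k => Θ) :=
    (isCompact_stdSimplex ℝ (Fin k)).prod (isCompact_univ_pi fun _ => hΘ)
  obtain ⟨⟨r, η⟩, ⟨hr, hη⟩, s, hs, hlim⟩ :=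
    hK.tendsto_subseq (x := fun n => (p n, θ n)) fun n => ⟨hp n, fun i _ => hθ n i⟩
  have hη' : ∀ i, η i ∈ Θ := fun i => hη i (Set.mem_univ i)
  have hlimp : Tendsto (fun n => p (s n)) atTop (𝓝 r) := hlim.fst_nhds
  have hlimθ : Tendsto (fun n => θ (s n)) atTop (𝓝 η) := hlim.snd_nhds
  refine ⟨ofAtoms r η, by simpa using mixG_ofAtoms hr hη', s, hs, fun φ hφ => ?_, fun ρ hρ => ?_⟩
  · simpa only [hpθ] using
      tendsto_mixInt_ofAtoms (fun n => hθ (s n)) hη' hlimp hlimθ hφ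
  · simpa only [hpθ] using
      tendsto_Wpow_one_ofAtoms (fun n => hp (s n)) hr hlimp hlimθ hρ

/-- Measures close to `G0` and measures bounded away from `G0` are uniformly separated by `Φ`. -/
lemma exists_le_phiDist_of_far {Θ : Set (Euc q)} (hΘ : IsCompact Θ) {k : ℕ}
    {Φ : Set (Euc q → ℝ)} (hcont : ∀ φ ∈ Φ, ContinuousOn φ Θ) {G0 : Euc q →₀ ℝ}
    (hG0 : IsMixingMeasure Θ G0)
    (hdist : ∀ G H : Euc q →₀ ℝ, MixG Θ k G → MixG Θ k H → G ≠ H → 0 < phiDist Φ G H)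
    {r0 : ℝ} (hr0 : 0 < r0) :
    ∃ r > (0 : ℝ), ∀ G H : Euc q →₀ ℝ, MixG Θ k G → MixG Θ k H → Wpow 1 G0 G < r →
      r0 < Wpow 1 H G0 → ENNReal.ofReal r ≤ phiDist Φ G H := by
  by_contra! hcon
  choose G H hG hH hGr hHr hlt using fun n : ℕ => hcon (1 / ((n : ℝ) + 1)) (by positivity)
  obtain ⟨G', hG', s, hs, hGφ, -⟩ := exists_subseq_tendsto_mixG hΘ hG
  obtain ⟨H', hH', u, hu, hHφ, hHW⟩ := exists_subseq_tendsto_mixG hΘ fun n => hH (s n)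
  have hzero : Tendsto (fun n => 1 / (((s (u n) : ℕ) : ℝ) + 1)) atTop (𝓝 0) :=
    tendsto_one_div_add_atTop_nhds_zero_nat.comp (hs.comp hu).tendsto_atTop
  have hlimG : ∀ φ, ContinuousOn φ Θ →
      Tendsto (fun n => mixInt (G (s (u n))) φ) atTop (𝓝 (mixInt G' φ)) :=
    fun φ hφ => (hGφ φ hφ).comp hu.tendsto_atTop
  have hGG0 : G' = G0 := by
    refine eq_of_forall_mixInt_eq fun φ hφ => ?_
    have hφc : Continuous φ := (LipschitzWith.of_dist_le_mul (K := 1) fun x y => by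
      simpa [Real.dist_eq, dist_eq_norm] using hφ x y).continuous
    have h1 : Tendsto (fun n => |mixInt G0 φ - mixInt (G (s (u n))) φ|) atTop
        (𝓝 |mixInt G0 φ - mixInt G' φ|) :=
      (tendsto_const_nhds.sub (hlimG φ hφc.continuousOn)).abs
    have h2 := le_of_tendsto_of_tendsto' h1 hzero fun n =>
      (abs_mixInt_sub_le_Wpow_one hG0 (hG _).1 hφ).trans (hGr _).le
    exact (sub_eq_zero.mp (abs_nonpos_iff.mp h2)).symm
  have hne : G' ≠ H' := by
    rintro rfl
    obtain ⟨n, hn⟩ := (hHW r0 hr0).exists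
    rw [hGG0] at hn
    exact absurd (hHr _) hn.not_gt
  refine (hdist G' H' hG' hH' hne).ne' ?_
  refine le_antisymm (iSup₂_le fun φ hφ => ?_) bot_le
  have h1 : Tendsto (fun n => |mixInt (G (s (u n))) φ - mixInt (H (s (u n))) φ|) atTop
      (𝓝 |mixInt G' φ - mixInt H' φ|) :=
    ((hlimG φ (hcont φ hφ)).sub (hHφ φ (hcont φ hφ))).abs
  have h2 := le_of_tendsto_of_tendsto' h1 hzero fun n => by
    have h3 : ENNReal.ofReal |mixInt (G (s (u n))) φ - mixInt (H (s (u n))) φ| ≤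
        phiDist Φ (G (s (u n))) (H (s (u n))) := le_iSup₂ (f := fun φ (_ : φ ∈ Φ) =>
          ENNReal.ofReal |mixInt (G (s (u n))) φ - mixInt (H (s (u n))) φ|) φ hφ
    exact (ENNReal.ofReal_le_ofReal_iff (by positivity)).mp (h3.trans (hlt _).le)
  exact (ENNReal.ofReal_eq_zero.mpr h2).le

end Helpers

/-- consequence of the local inverse bound at `G0` for arbitrary estimates. -/
theorem consequence_of_local_inverse_bound {q k k0 : ℕ} (hk0 : 1 ≤ k0) (hk0k : k0 ≤ k)
    (Θ : Set (Euc q)) (hΘ : IsCompact Θ)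
    (Φ : Set (Euc q → ℝ)) (hcont : ∀ φ ∈ Φ, ContinuousOn φ Θ)
    (G0 : Euc q →₀ ℝ) (hG0 : MixE Θ k0 G0)
    (hdist : ∀ G H : Euc q →₀ ℝ, MixG Θ k G → MixG Θ k H → G ≠ H → 0 < phiDist Φ G H)
    (hloc : ∃ r0 > (0:ℝ), ∃ c0 > (0:ℝ), ∀ G H : Euc q →₀ ℝ,
      MixG Θ k G → MixG Θ k H → G ≠ H →
      Wpow 1 G G0 ≤ r0 → Wpow 1 H G0 ≤ r0 →
      ENNReal.ofReal (c0 * Wpow ((2 * (k - k0 + 1) - 1 : ℕ) : ℝ) G H) ≤ phiDist Φ G H) :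
    ∃ r > (0:ℝ), ∃ C > (0:ℝ), ∀ G Hhat : Euc q →₀ ℝ, MixG Θ k G → MixG Θ k Hhat →
      Wpow 1 G0 G < r → ∀ t : ℝ, 0 < t →
      t ≤ Wpow ((2 * (k - k0 + 1) - 1 : ℕ) : ℝ) G Hhat →
      ENNReal.ofReal (C * min t 1) ≤ phiDist Φ G Hhat := by
  obtain ⟨r0, hr0, c0, hc0, hloc⟩ := hloc
  obtain ⟨ε, hε, hfar⟩ := exists_le_phiDist_of_far hΘ hcont hG0.1 hdist hr0
  refine ⟨min ε r0, lt_min hε hr0, min c0 ε, lt_min hc0 hε, fun G H hG hH hGr t ht htW => ?_⟩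
  have hm : 0 ≤ min t 1 := le_min ht.le zero_le_one
  by_cases hHr : Wpow 1 H G0 ≤ r0
  · have hne : G ≠ H := by
      rintro rfl
      have hℓ : ((2 * (k - k0 + 1) - 1 : ℕ) : ℝ) ≠ 0 := Nat.cast_ne_zero.mpr (by omega)
      exact absurd (htW.trans (Wpow_self_nonpos hG.1 hℓ)) ht.not_ge
    have hGr0 : Wpow 1 G G0 ≤ r0 := by
      rw [Wpow_comm]
      exact (hGr.trans_le (min_le_right _ _)).le
    refine le_trans (ENNReal.ofReal_le_ofReal ?_) (hloc G H hG hH hne hGr0 hHr)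
    exact mul_le_mul (min_le_left _ _) ((min_le_left _ _).trans htW) hm hc0.le
  · refine le_trans (ENNReal.ofReal_le_ofReal ?_)
      (hfar G H hG hH (hGr.trans_le (min_le_left _ _)) (not_le.mp hHr))
    calc min c0 ε * min t 1 ≤ ε * 1 := mul_le_mul (min_le_right _ _) (min_le_right _ _) hm hε.le
      _ = ε := mul_one ε

end
end

section
/- Let G and H be finitely supported probability measures on ℝ^q, each with at most k atoms. If m_α(G) = m_α(H) for every multi-index α ∈ ℕ^q with |α| ≤ 2k − 1, then G = H. -/
open scoped BigOperators ENNReal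

noncomputable section

/-- The moment `m_α(G) = ∑ᵢ wᵢ θᵢ^α` of a finitely supported measure. -/
def moment {q : ℕ} (α : Fin q → ℕ) (G : Euc q →₀ ℝ) : ℝ :=
  ∑ x ∈ G.support, G x * ∏ j, (x j) ^ (α j)

open MvPolynomial in
/-- The integral of a polynomial is the combination of moments given by its coefficients. -/
theorem mixInt_eval_eq_sum_moment {q : ℕ} (G : Euc q →₀ ℝ) (p : MvPolynomial (Fin q) ℝ) :
    mixInt G (fun x => eval (fun j => x j) p) = ∑ d ∈ p.support, p.coeff d * moment d G := by
  simp only [mixInt, moment, eval_eq', Finset.mul_sum]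
  rw [Finset.sum_comm]
  exact Finset.sum_congr rfl fun d _ => Finset.sum_congr rfl fun x _ => by ring

open MvPolynomial in
/-- Measures whose moments agree up to degree `n` integrate polynomials of degree at most `n`
equally. -/
theorem mixInt_eval_eq_of_moment_eq {q n : ℕ} {G H : Euc q →₀ ℝ}
    (hmom : ∀ α : Fin q → ℕ, (∑ j, α j) ≤ n → moment α G = moment α H)
    {p : MvPolynomial (Fin q) ℝ} (hp : p.totalDegree ≤ n) :
    mixInt G (fun x => eval (fun j => x j) p) = mixInt H (fun x => eval (fun j => x j) p) := by
  simp only [mixInt_eval_eq_sum_moment]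
  refine Finset.sum_congr rfl fun d hd => ?_
  have hdeg := (le_totalDegree hd).trans hp
  rw [Finsupp.sum_fintype _ _ fun _ => rfl] at hdeg
  rw [hmom d hdeg]

open MvPolynomial in
/-- A point is separated from a finite set not containing it by a product of affine forms, one for
each point of the set. -/
theorem exists_totalDegree_le_card_eval_ne_zero {q : ℕ} (s : Finset (Euc q)) {a : Euc q}
    (ha : a ∉ s) :
    ∃ p : MvPolynomial (Fin q) ℝ, p.totalDegree ≤ s.card ∧ eval (fun j => a j) p ≠ 0 ∧
      ∀ y ∈ s, eval (fun j => y j) p = 0 := by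
  have hcoord : ∀ y : s, ∃ j, a j ≠ (y : Euc q) j := fun y => by
    by_contra! h
    exact ha ((PiLp.ext h : a = y) ▸ y.2)
  choose j hj using hcoord
  refine ⟨∏ y : s, (X (j y) - C ((y : Euc q) (j y))), ?_, ?_, fun y hy => ?_⟩
  · refine (totalDegree_finsetProd _ _).trans ?_
    refine (Finset.sum_le_card_nsmul _ _ 1 fun y _ => ?_).trans (by simp)
    exact (totalDegree_sub_C_le _ _).trans (totalDegree_X _).le
  · simpa [Finset.prod_eq_zero_iff, sub_eq_zero] using fun y hy => hj ⟨y, hy⟩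
  · rw [map_prod]
    exact Finset.prod_eq_zero (Finset.mem_univ ⟨y, hy⟩) (by simp)

/-- Integrating a function that vanishes on the support away from `a` picks out the mass at `a`. -/
theorem mixInt_eq_mul_of_forall_ne {q : ℕ} (G : Euc q →₀ ℝ) {φ : Euc q → ℝ} {a : Euc q}
    (hφ : ∀ x ∈ G.support, x ≠ a → φ x = 0) : mixInt G φ = G a * φ a :=
  Finset.sum_eq_single a (fun x hx hxa => by rw [hφ x hx hxa, mul_zero])
    fun h => by rw [Finsupp.notMem_support_iff.mp h, zero_mul]

/-- discrete probability measures on `ℝ^q` with at most `k` atoms are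
determined by their moments of total degree `≤ 2k - 1`. -/
theorem moments_determine_discrete_measures {q k : ℕ} (G H : Euc q →₀ ℝ)
    (hG : IsMixingMeasure Set.univ G) (hH : IsMixingMeasure Set.univ H)
    (hGk : G.support.card ≤ k) (hHk : H.support.card ≤ k)
    (hmom : ∀ α : Fin q → ℕ, (∑ j, α j) ≤ 2 * k - 1 → moment α G = moment α H) :
    G = H := by
  classical
  ext a
  by_cases ha : a ∈ G.support ∪ H.support
  · obtain ⟨p, hdeg, hpa, hp⟩ := exists_totalDegree_le_card_eval_ne_zero
      ((G.support ∪ H.support).erase a) (Finset.notMem_erase a _)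
    have hcard : ((G.support ∪ H.support).erase a).card ≤ 2 * k - 1 := by
      rw [Finset.card_erase_of_mem ha]
      have := Finset.card_union_le G.support H.support
      omega
    have hint := mixInt_eval_eq_of_moment_eq hmom (hdeg.trans hcard)
    rw [mixInt_eq_mul_of_forall_ne G fun x hx hxa =>
        hp x (Finset.mem_erase.mpr ⟨hxa, Finset.mem_union_left _ hx⟩),
      mixInt_eq_mul_of_forall_ne H fun x hx hxa =>
        hp x (Finset.mem_erase.mpr ⟨hxa, Finset.mem_union_right _ hx⟩)] at hint
    exact mul_right_cancel₀ hpa hint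
  · rw [Finset.notMem_union, Finsupp.notMem_support_iff, Finsupp.notMem_support_iff] at ha
    rw [ha.1, ha.2]

end
end
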